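/- For every nondegenerate right triangle T_R in ℝ², the first mixed eigenvalue with Dirichlet condition on the hypotenuse and Neumann condition on the two legs satisfies λ₁^{L}(T_R) ≥ π²/(2|T_R|). -/

import Mathlib

open MeasureTheory Set EuclideanGeometry

noncomputable section

abbrev E2 : Type := EuclideanSpace ℝ (Fin 2)

/-- The Rayleigh quotient of a function `u` on the domain `Ω ⊆ ℝ²`. -/
def rayleigh (Ω : Set E2) (u : E2 → ℝ) : ℝ :=
  (∫ x in Ω, ‖fderiv ℝ u x‖ ^ 2) / (∫ x in Ω, (u x) ^ 2)

/-- `u` is not almost everywhere zero on `Ω`. -/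
def NotAEZero (Ω : Set E2) (u : E2 → ℝ) : Prop :=
  ¬ (∀ᵐ x ∂(volume.restrict Ω), u x = 0)

/-- The first mixed Dirichlet–Neumann eigenvalue of the Laplacian on `Ω`,
with Dirichlet condition on `D` and Neumann condition on the rest of the boundary,
defined variationally. -/
def firstMixedEig (Ω D : Set E2) : ℝ :=
  sInf { r | ∃ u : E2 → ℝ, ContDiff ℝ (⊤ : ℕ∞) u ∧ (∀ x ∈ D, u x = 0) ∧
    NotAEZero Ω u ∧ r = rayleigh Ω u }

/-- The `k`-th mixed Dirichlet–Neumann eigenvalue of the Laplacian on `Ω`,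
with Dirichlet condition on `D`, via the Courant–Fischer min–max principle. -/
def mixedEig (Ω D : Set E2) (k : ℕ) : ℝ :=
  sInf { r | ∃ V : Submodule ℝ (E2 → ℝ), Module.finrank ℝ V = k ∧
    (∀ u ∈ V, ContDiff ℝ (⊤ : ℕ∞) u ∧ ∀ x ∈ D, u x = 0) ∧
    r = sSup { q | ∃ u ∈ V, NotAEZero Ω u ∧ q = rayleigh Ω u } }

/-- The open triangle with vertices `A`, `B`, `C`. -/
def triangleO (A B C : E2) : Set E2 := interior (convexHull ℝ ({A, B, C} : Set E2))

/-- The area of a plane region. -/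
def area2 (s : Set E2) : ℝ := (volume s).toReal

/-- The open rectangle `(0,a) × (0,b)`. -/
def rectO (a b : ℝ) : Set E2 := {p : E2 | p 0 ∈ Ioo 0 a ∧ p 1 ∈ Ioo 0 b}

/-- The closed rectangle `[0,a] × [0,b]`. -/
def rectC (a b : ℝ) : Set E2 := {p : E2 | p 0 ∈ Icc 0 a ∧ p 1 ∈ Icc 0 b}

/-- The two vertical sides of the closed rectangle `[0,a] × [0,b]`. -/
def vSides (a b : ℝ) : Set E2 := {p : E2 | (p 0 = 0 ∨ p 0 = a) ∧ p 1 ∈ Icc 0 b}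

/-- The two horizontal sides of the closed rectangle `[0,a] × [0,b]`. -/
def hSides (a b : ℝ) : Set E2 := {p : E2 | p 0 ∈ Icc 0 a ∧ (p 1 = 0 ∨ p 1 = b)}

/-- `F(y) = Σ_{j=0}^∞ ((y − j²)₊)^{1/2}`. -/
def Ffun (y : ℝ) : ℝ := ∑' j : ℕ, Real.sqrt (max (y - (j : ℝ) ^ 2) 0)

/-- `M`, the inverse function of `F` on `[0,∞)`. -/
def Mfun (x : ℝ) : ℝ := sInf {y : ℝ | 0 ≤ y ∧ x ≤ Ffun y}

lemma poincare_interval_aux {f f' : ℝ → ℝ} {S : Set ℝ} (hS : S.Countable) {c ρ k : ℝ}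
    (hρ : 0 < ρ) (hk : 0 < k) (hkρ : k * ρ < Real.pi / 2) (hf : Continuous f)
    (hz : ∀ t, ρ ≤ |t - c| → f t = 0) (hd : ∀ t ∉ S, HasDerivAt f (f' t) t)
    (hi : Integrable f') (hi2 : Integrable fun t => f' t ^ 2) :
    k ^ 2 * ∫ t, f t ^ 2 ≤ ∫ t, f' t ^ 2 := by
  have hle : c - ρ ≤ c + ρ := by linarith
  have hcos : ∀ t ∈ Icc (c - ρ) (c + ρ), Real.cos (k * (t - c)) ≠ 0 := by
    intro t ht
    refine (Real.cos_pos_of_mem_Ioo ⟨?_, ?_⟩).ne' <;> nlinarith [ht.1, ht.2]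
  have htan : ContinuousOn (fun t => Real.tan (k * (t - c))) (Icc (c - ρ) (c + ρ)) := by
    intro t ht
    exact ((Real.continuousAt_tan.2 (hcos t ht)).comp
      (f := fun t => k * (t - c)) (by fun_prop)).continuousWithinAt
  have hint : IntervalIntegrable f' volume (c - ρ) (c + ρ) := hi.intervalIntegrable
  have hI : IntervalIntegrable (fun t => (2 * f t * (k * Real.tan (k * (t - c)))) * f' t +
      k ^ 2 * (f t ^ 2 * (1 + Real.tan (k * (t - c)) ^ 2))) volume (c - ρ) (c + ρ) := by
    rw [← uIcc_of_le hle] at htan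
    refine (hint.continuousOn_mul ?_).add (ContinuousOn.intervalIntegrable ?_) <;> fun_prop
  have key := MeasureTheory.integral_eq_of_hasDerivAt_off_countable
    (fun t => f t ^ 2 * (k * Real.tan (k * (t - c))))
    (fun t => (2 * f t * (k * Real.tan (k * (t - c)))) * f' t +
      k ^ 2 * (f t ^ 2 * (1 + Real.tan (k * (t - c)) ^ 2))) (a := c - ρ) (b := c + ρ) hS
    (by rw [uIcc_of_le hle]; fun_prop) (by
      intro t ht
      rw [min_eq_left hle, max_eq_right hle] at ht
      have hc := hcos t (Ioo_subset_Icc_self ht.1)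
      have h1 : HasDerivAt (fun t => k * (t - c)) k t := by
        simpa using ((hasDerivAt_id t).sub_const c).const_mul k
      have h2 := (Real.hasDerivAt_tan hc).comp t h1
      have h3 := ((hd t ht.2).pow 2).mul (h2.const_mul k)
      refine h3.congr_deriv ?_
      have : 1 / Real.cos (k * (t - c)) ^ 2 = 1 + Real.tan (k * (t - c)) ^ 2 := by
        rw [← Real.inv_one_add_tan_sq hc]; simp
      rw [this]
      simp
      ring) hI
  rw [hz (c + ρ) (by simp [le_abs_self]), hz (c - ρ) (by simp [le_abs_self])] at key
  have hf2 : ∫ t, f t ^ 2 = ∫ t in (c - ρ)..(c + ρ), f t ^ 2 := by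
    rw [intervalIntegral.integral_of_le hle, ← integral_Icc_eq_integral_Ioc,
      setIntegral_eq_integral_of_forall_compl_eq_zero]
    intro t ht
    rw [hz t, zero_pow two_ne_zero]
    by_contra! h
    rw [abs_lt] at h
    exact ht ⟨by linarith, by linarith⟩
  have hf'2 : ∫ t in (c - ρ)..(c + ρ), f' t ^ 2 ≤ ∫ t, f' t ^ 2 := by
    rw [intervalIntegral.integral_of_le hle]
    exact setIntegral_le_integral hi2 (Filter.Eventually.of_forall fun t => sq_nonneg _)
  have hfi : IntervalIntegrable (fun t => k ^ 2 * f t ^ 2) volume (c - ρ) (c + ρ) :=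
    (by fun_prop : Continuous fun t => k ^ 2 * f t ^ 2).intervalIntegrable _ _
  have hmono : ∫ t in (c - ρ)..(c + ρ), (k ^ 2 * f t ^ 2 - f' t ^ 2) ≤
      ∫ t in (c - ρ)..(c + ρ), ((2 * f t * (k * Real.tan (k * (t - c)))) * f' t +
      k ^ 2 * (f t ^ 2 * (1 + Real.tan (k * (t - c)) ^ 2))) := by
    refine intervalIntegral.integral_mono hle (hfi.sub hi2.intervalIntegrable) hI fun t => ?_
    simp only
    nlinarith [sq_nonneg (f' t + k * f t * Real.tan (k * (t - c)))]
  rw [intervalIntegral.integral_sub hfi hi2.intervalIntegrable,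
    intervalIntegral.integral_const_mul] at hmono
  rw [hf2]
  norm_num at key
  linarith

/-- The one-dimensional Dirichlet Poincaré inequality with the sharp constant, for continuous
functions supported in `[c - ρ, c + ρ]` and differentiable outside a countable set. -/
lemma poincare_interval {f f' : ℝ → ℝ} {S : Set ℝ} (hS : S.Countable) {c ρ : ℝ}
    (hρ : 0 < ρ) (hf : Continuous f)
    (hz : ∀ t, ρ ≤ |t - c| → f t = 0) (hd : ∀ t ∉ S, HasDerivAt f (f' t) t)
    (hi : Integrable f') (hi2 : Integrable fun t => f' t ^ 2) :
    (Real.pi / (2 * ρ)) ^ 2 * ∫ t, f t ^ 2 ≤ ∫ t, f' t ^ 2 := by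
  have hlim : Filter.Tendsto (fun k : ℝ => k ^ 2 * ∫ t, f t ^ 2)
      (nhdsWithin (Real.pi / (2 * ρ)) (Iio (Real.pi / (2 * ρ))))
      (nhds ((Real.pi / (2 * ρ)) ^ 2 * ∫ t, f t ^ 2)) :=
    ((by fun_prop : Continuous fun k : ℝ => k ^ 2 * ∫ t, f t ^ 2).tendsto _).mono_left
      nhdsWithin_le_nhds
  refine le_of_tendsto hlim ?_
  have hpos : 0 < Real.pi / (2 * ρ) := by positivity
  filter_upwards [Ioo_mem_nhdsLT hpos] with k hk
  refine poincare_interval_aux hS hρ hk.1 ?_ hf hz hd hi hi2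
  have := hk.2
  rw [lt_div_iff₀ (by positivity)] at this
  linarith

/-- Integrating a function of `(|x|, |y|)` over the plane gives four times the integral over the
open first quadrant. -/
lemma integral_comp_abs_abs {F : ℝ × ℝ → ℝ}
    (hF : Integrable fun p : ℝ × ℝ => F (|p.1|, |p.2|)) :
    ∫ p : ℝ × ℝ, F (|p.1|, |p.2|) = 4 * ∫ p in Ioi 0 ×ˢ Ioi 0, F p := by
  have hF' : IntegrableOn F (Ioi (0 : ℝ) ×ˢ Ioi (0 : ℝ)) := by
    refine hF.integrableOn.congr_fun ?_ (measurableSet_Ioi.prod measurableSet_Ioi)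
    intro p hp
    simp only [abs_of_pos (mem_Ioi.1 hp.1), abs_of_pos (mem_Ioi.1 hp.2)]
  rw [Measure.volume_eq_prod] at hF hF' ⊢
  rw [integral_prod _ hF, setIntegral_prod _ hF']
  have h1 : ∀ x : ℝ, ∫ y, F (|x|, |y|) = 2 * ∫ y in Ioi (0 : ℝ), F (|x|, y) := fun x =>
    integral_comp_abs (f := fun y => F (|x|, y))
  simp only [h1]
  rw [integral_comp_abs (f := fun x => 2 * ∫ y in Ioi (0 : ℝ), F (x, y)), integral_const_mul]
  ring

/-- Fubini theorem along the lines of slope one. -/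
lemma integral_diagonal {F : ℝ × ℝ → ℝ} (hF : Integrable F) :
    (∀ᵐ m : ℝ, Integrable fun t => F (t, t + m)) ∧ (Integrable fun m => ∫ t, F (t, t + m)) ∧
      ∫ p, F p = ∫ m, ∫ t, F (t, t + m) := by
  have hmp : MeasurePreserving (fun z : ℝ × ℝ => (z.1, z.1 + z.2)) volume volume :=
    measurePreserving_prod_add volume volume
  have hemb : MeasurableEmbedding (fun z : ℝ × ℝ => (z.1, z.1 + z.2)) :=
    (MeasurableEquiv.shearAddRight ℝ).measurableEmbedding
  have h : Integrable (fun z : ℝ × ℝ => F (z.1, z.1 + z.2)) (volume.prod volume) :=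
    (hmp.integrable_comp_emb hemb).2 hF
  refine ⟨h.prod_left_ae, h.integral_prod_right, ?_⟩
  rw [← hmp.integral_comp hemb]
  exact integral_prod_symm _ h

/-- The integral over the plane of a function that is odd in the first variable vanishes. -/
lemma integral_eq_zero_of_odd_fst {F : ℝ × ℝ → ℝ} (hF : ∀ x y, F (-x, y) = -F (x, y)) :
    ∫ p, F p = 0 := by
  have hmp : MeasurePreserving ((MeasurableEquiv.neg ℝ).prodCongr (MeasurableEquiv.refl ℝ))
      volume volume :=
    (Measure.measurePreserving_neg (volume : Measure ℝ)).prod (MeasurePreserving.id volume)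
  have h := hmp.integral_comp' F
  have h' : ∀ p : ℝ × ℝ, F (((MeasurableEquiv.neg ℝ).prodCongr (MeasurableEquiv.refl ℝ)) p) =
      -F p := fun p => hF p.1 p.2
  simp only [h', integral_neg] at h
  linarith

/-- The closed rhombus with vertices `(±a, 0)` and `(0, ±b)`. -/
def closedRhombus (a b : ℝ) : Set (ℝ × ℝ) := {p | |p.1| / a + |p.2| / b ≤ 1}

/-- The closed triangle with vertices `(0, 0)`, `(a, 0)` and `(0, b)`. -/
def legTriangle (a b : ℝ) : Set (ℝ × ℝ) := {p | 0 ≤ p.1 ∧ 0 ≤ p.2 ∧ p.1 / a + p.2 / b ≤ 1}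

lemma isCompact_closedRhombus {a b : ℝ} (ha : 0 < a) (hb : 0 < b) :
    IsCompact (closedRhombus a b) := by
  refine (isCompact_Icc (a := ((-a, -b) : ℝ × ℝ)) (b := (a, b))).of_isClosed_subset
    (isClosed_le (f := fun p : ℝ × ℝ => |p.1| / a + |p.2| / b) (by fun_prop)
      continuous_const) ?_
  intro p hp
  have hp : |p.1| / a + |p.2| / b ≤ 1 := hp
  have h1 : |p.1| / a ≤ 1 := by linarith [div_nonneg (abs_nonneg p.2) hb.le]
  have h2 : |p.2| / b ≤ 1 := by linarith [div_nonneg (abs_nonneg p.1) ha.le]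
  rw [div_le_one (by assumption), abs_le] at h1 h2
  exact ⟨⟨h1.1, h2.1⟩, ⟨h1.2, h2.2⟩⟩

lemma isClosed_legTriangle (a b : ℝ) : IsClosed (legTriangle a b) :=
  (isClosed_le continuous_const continuous_fst).inter
    ((isClosed_le continuous_const continuous_snd).inter
      (isClosed_le (f := fun p : ℝ × ℝ => p.1 / a + p.2 / b) (by fun_prop) continuous_const))

lemma isCompact_legTriangle {a b : ℝ} (ha : 0 < a) (hb : 0 < b) :
    IsCompact (legTriangle a b) := by
  refine (isCompact_closedRhombus ha hb).of_isClosed_subset (isClosed_legTriangle a b) ?_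
  rintro p ⟨h1, h2, h3⟩
  simpa [closedRhombus, abs_of_nonneg h1, abs_of_nonneg h2] using h3

lemma setIntegral_closedRhombus {a b : ℝ} (ha : 0 < a) (hb : 0 < b) {g : ℝ × ℝ → ℝ}
    (hg : Continuous g) :
    ∫ p in closedRhombus a b, g (|p.1|, |p.2|) = 4 * ∫ p in legTriangle a b, g p := by
  have hR := isCompact_closedRhombus ha hb
  have hind : ∀ p : ℝ × ℝ, (closedRhombus a b).indicator (fun p => g (|p.1|, |p.2|)) p =
      (closedRhombus a b).indicator g (|p.1|, |p.2|) := by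
    intro p
    simp only [indicator, closedRhombus, mem_ofPred_eq, abs_abs]
    congr
  have hi : Integrable fun p : ℝ × ℝ => (closedRhombus a b).indicator g (|p.1|, |p.2|) := by
    simp only [← hind]
    rw [integrable_indicator_iff hR.measurableSet]
    exact (Continuous.continuousOn (by fun_prop)).integrableOn_compact hR
  rw [← integral_indicator hR.measurableSet]
  simp only [hind]
  rw [integral_comp_abs_abs hi, setIntegral_indicator hR.measurableSet]
  congr 1
  refine setIntegral_congr_set ?_
  have h1 : (Ioi (0 : ℝ) ×ˢ Ioi (0 : ℝ) : Set (ℝ × ℝ)) =ᵐ[volume] Ici (0 : ℝ) ×ˢ Ici (0 : ℝ) :=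
    Measure.set_prod_ae_eq Ioi_ae_eq_Ici Ioi_ae_eq_Ici
  refine (h1.inter (Filter.EventuallyEq.refl _ (closedRhombus a b))).trans
    (Filter.EventuallyEq.of_eq ?_)
  ext p
  constructor
  · rintro ⟨⟨h1, h2⟩, h3⟩
    have h1 : 0 ≤ p.1 := h1
    have h2 : 0 ≤ p.2 := h2
    refine ⟨h1, h2, ?_⟩
    simpa [closedRhombus, abs_of_nonneg h1, abs_of_nonneg h2] using h3
  · rintro ⟨h1, h2, h3⟩
    refine ⟨⟨h1, h2⟩, ?_⟩
    simpa [closedRhombus, abs_of_nonneg h1, abs_of_nonneg h2] using h3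

/-- The extension of a function on the first quadrant to the rhombus by even reflection in both
axes, and by zero outside the rhombus. -/
def evenExt (a b : ℝ) (v : ℝ × ℝ → ℝ) : ℝ × ℝ → ℝ :=
  (closedRhombus a b).indicator fun p => v (|p.1|, |p.2|)

/-- The derivative of `evenExt a b v` in the direction `(1, 1)`. -/
def evenExtDeriv (a b : ℝ) (v : ℝ × ℝ → ℝ) : ℝ × ℝ → ℝ :=
  (closedRhombus a b).indicator fun p =>
    p.1 / |p.1| * fderiv ℝ v (|p.1|, |p.2|) (1, 0) + p.2 / |p.2| * fderiv ℝ v (|p.1|, |p.2|) (0, 1)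

lemma evenExt_eq_zero {a b : ℝ} {v : ℝ × ℝ → ℝ}
    (h0 : ∀ p : ℝ × ℝ, 0 ≤ p.1 → 0 ≤ p.2 → p.1 / a + p.2 / b = 1 → v p = 0)
    {p : ℝ × ℝ} (hp : 1 ≤ |p.1| / a + |p.2| / b) : evenExt a b v p = 0 := by
  rcases hp.lt_or_eq with h | h
  · exact indicator_of_notMem (by simpa [closedRhombus] using h) _
  · rw [evenExt, indicator_of_mem (by simp [closedRhombus, ← h])]
    exact h0 _ (abs_nonneg _) (abs_nonneg _) h.symm

lemma continuous_evenExt {a b : ℝ} {v : ℝ × ℝ → ℝ} (hv : Continuous v)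
    (h0 : ∀ p : ℝ × ℝ, 0 ≤ p.1 → 0 ≤ p.2 → p.1 / a + p.2 / b = 1 → v p = 0) :
    Continuous (evenExt a b v) := by
  classical
  have : evenExt a b v =
      fun p => if |p.1| / a + |p.2| / b ≤ 1 then v (|p.1|, |p.2|) else 0 := by
    ext p
    simp only [evenExt, indicator, closedRhombus, mem_ofPred_eq]
    congr
  rw [this]
  exact Continuous.if_le (by fun_prop) (by fun_prop) (by fun_prop) (by fun_prop)
    fun p hp => h0 _ (abs_nonneg _) (abs_nonneg _) hp

lemma hasDerivAt_abs_div {x : ℝ} (hx : x ≠ 0) : HasDerivAt (fun t => |t|) (x / |x|) x := by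
  rcases hx.lt_or_gt with h | h
  · rw [abs_of_neg h, div_neg, div_self hx]
    exact hasDerivAt_abs_neg h
  · rw [abs_of_pos h, div_self hx]
    exact hasDerivAt_abs_pos h

lemma hasDerivAt_evenExt {a b : ℝ} {v : ℝ × ℝ → ℝ} (hv : ContDiff ℝ 1 v) {m t : ℝ}
    (ht : t ≠ 0) (htm : t + m ≠ 0) (hne : |t| / a + |t + m| / b ≠ 1) :
    HasDerivAt (fun t => evenExt a b v (t, t + m)) (evenExtDeriv a b v (t, t + m)) t := by
  have hc : Continuous fun t : ℝ => |t| / a + |t + m| / b := by fun_prop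
  rcases hne.lt_or_gt with h | h
  · have hmem : (t, t + m) ∈ closedRhombus a b := h.le
    have h1 := hasDerivAt_abs_div ht
    have h2 : HasDerivAt (fun t => |t + m|) ((t + m) / |t + m|) t :=
      (hasDerivAt_abs_div htm).comp_add_const t m
    have h3 := ((hv.differentiable one_ne_zero) (|t|, |t + m|)).hasFDerivAt.comp_hasDerivAt t
      (h1.prodMk h2)
    rw [evenExtDeriv, indicator_of_mem hmem]
    refine (h3.congr_of_eventuallyEq ?_).congr_deriv ?_
    · filter_upwards [hc.continuousAt.eventually_lt continuousAt_const h] with s hs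
      exact indicator_of_mem (show (s, s + m) ∈ closedRhombus a b from hs.le) _
    · have : ((t / |t|, (t + m) / |t + m|) : ℝ × ℝ) =
          (t / |t|) • ((1, 0) : ℝ × ℝ) + ((t + m) / |t + m|) • ((0, 1) : ℝ × ℝ) := by
        ext <;> simp
      rw [this, map_add, map_smul, map_smul]
      simp
  · rw [evenExtDeriv, indicator_of_notMem (by simpa [closedRhombus] using h)]
    refine (hasDerivAt_const t (0 : ℝ)).congr_of_eventuallyEq ?_
    filter_upwards [continuousAt_const.eventually_lt hc.continuousAt h] with s hs
    exact indicator_of_notMem (by simpa [closedRhombus] using hs) _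

/-- A line of slope one not containing a side of the rhombus meets its boundary in finitely many
points. -/
lemma finite_diagonal_inter_frontier {a b m : ℝ} (ha : 0 < a) (hb : 0 < b) (hm : m ≠ b)
    (hm' : m ≠ -b) : {t : ℝ | |t| / a + |t + m| / b = 1}.Finite := by
  refine (Set.toFinite {a * (b - m) / (a + b), a * (b + m) / (b - a), a * (m - b) / (b - a),
    -(a * (b + m) / (a + b))}).subset ?_
  intro t ht
  have ht : |t| / a + |t + m| / b = 1 := ht
  have hab : a + b ≠ 0 := by positivity
  field_simp at ht
  simp only [mem_insert_iff, mem_singleton_iff]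
  rcases abs_cases t with ⟨h1, -⟩ | ⟨h1, -⟩ <;> rcases abs_cases (t + m) with ⟨h2, -⟩ | ⟨h2, -⟩ <;>
    rw [h1, h2] at ht
  · left
    rw [eq_div_iff hab]; linarith
  · right; left
    have : b - a ≠ 0 := by
      intro h
      have hba : b = a := by linarith
      subst hba
      exact hm' (mul_left_cancel₀ hb.ne' (by linarith))
    rw [eq_div_iff this]; linarith
  · by_cases h : b - a = 0
    · have hba : b = a := by linarith
      subst hba
      exact absurd (mul_left_cancel₀ hb.ne' (by linarith)) hm
    · right; right; left
      rw [eq_div_iff h]; linarith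
  · right; right; right
    rw [eq_neg_iff_add_eq_zero, ← eq_neg_iff_add_eq_zero, ← neg_div, eq_div_iff hab]; linarith

lemma abs_div_abs_self_le_one (x : ℝ) : |(x / |x|)| ≤ 1 := by
  rw [abs_div, abs_abs]
  exact div_self_le_one _

lemma div_abs_self_sq_le_one (x : ℝ) : (x / |x|) ^ 2 ≤ 1 :=
  (sq_le_one_iff_abs_le_one _).2 (abs_div_abs_self_le_one x)

lemma integrable_evenExtDeriv {a b : ℝ} (ha : 0 < a) (hb : 0 < b) {v : ℝ × ℝ → ℝ}
    (hv : ContDiff ℝ 1 v) : Integrable (evenExtDeriv a b v) := by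
  have hR := isCompact_closedRhombus ha hb
  have hdv : Continuous (fderiv ℝ v) := hv.continuous_fderiv one_ne_zero
  rw [evenExtDeriv, integrable_indicator_iff hR.measurableSet]
  have hA : ∀ w : ℝ × ℝ, IntegrableOn (fun p : ℝ × ℝ => fderiv ℝ v (|p.1|, |p.2|) w)
      (closedRhombus a b) := fun w =>
    (Continuous.continuousOn (by fun_prop)).integrableOn_compact hR
  exact ((hA (1, 0)).bdd_mul (c := 1) (Measurable.aestronglyMeasurable (by fun_prop))
      (Filter.Eventually.of_forall fun p => abs_div_abs_self_le_one p.1)).add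
    ((hA (0, 1)).bdd_mul (c := 1) (Measurable.aestronglyMeasurable (by fun_prop))
      (Filter.Eventually.of_forall fun p => abs_div_abs_self_le_one p.2))

lemma integral_evenExtDeriv_sq {a b : ℝ} (ha : 0 < a) (hb : 0 < b) {v : ℝ × ℝ → ℝ}
    (hv : ContDiff ℝ 1 v) :
    (Integrable fun p => evenExtDeriv a b v p ^ 2) ∧ ∫ p, evenExtDeriv a b v p ^ 2 ≤
      4 * ∫ p in legTriangle a b, (fderiv ℝ v p (1, 0) ^ 2 + fderiv ℝ v p (0, 1) ^ 2) := by
  have hR := isCompact_closedRhombus ha hb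
  have hdv : Continuous (fderiv ℝ v) := hv.continuous_fderiv one_ne_zero
  set s : ℝ × ℝ → ℝ := fun p =>
    (p.1 / |p.1|) ^ 2 * fderiv ℝ v (|p.1|, |p.2|) (1, 0) ^ 2 +
      (p.2 / |p.2|) ^ 2 * fderiv ℝ v (|p.1|, |p.2|) (0, 1) ^ 2 with hs
  set r : ℝ × ℝ → ℝ := fun p => 2 * ((p.1 / |p.1|) * ((p.2 / |p.2|) *
      (fderiv ℝ v (|p.1|, |p.2|) (1, 0) * fderiv ℝ v (|p.1|, |p.2|) (0, 1)))) with hr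
  have hD : (fun p => evenExtDeriv a b v p ^ 2) = (closedRhombus a b).indicator (s + r) := by
    ext p
    by_cases hp : p ∈ closedRhombus a b
    · simp only [evenExtDeriv, indicator_of_mem hp, hs, hr, Pi.add_apply]
      ring
    · simp [evenExtDeriv, indicator_of_notMem hp]
  have hbd : ∀ x : ℝ, ‖(x / |x|) ^ 2‖ ≤ 1 := fun x => by
    rw [Real.norm_of_nonneg (sq_nonneg _)]
    exact div_abs_self_sq_le_one x
  have hg : Continuous fun p : ℝ × ℝ => fderiv ℝ v p (1, 0) ^ 2 + fderiv ℝ v p (0, 1) ^ 2 := by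
    fun_prop
  have hA : ∀ w : ℝ × ℝ, IntegrableOn (fun p : ℝ × ℝ => fderiv ℝ v (|p.1|, |p.2|) w ^ 2)
      (closedRhombus a b) := fun w =>
    (Continuous.continuousOn (by fun_prop)).integrableOn_compact hR
  have hB : IntegrableOn (fun p : ℝ × ℝ => fderiv ℝ v (|p.1|, |p.2|) (1, 0) *
      fderiv ℝ v (|p.1|, |p.2|) (0, 1)) (closedRhombus a b) :=
    (Continuous.continuousOn (by fun_prop)).integrableOn_compact hR
  have hsi : IntegrableOn s (closedRhombus a b) :=
    ((hA (1, 0)).bdd_mul (c := 1) (Measurable.aestronglyMeasurable (by fun_prop))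
      (Filter.Eventually.of_forall fun p => hbd p.1)).add
    ((hA (0, 1)).bdd_mul (c := 1) (Measurable.aestronglyMeasurable (by fun_prop))
      (Filter.Eventually.of_forall fun p => hbd p.2))
  have hri : IntegrableOn r (closedRhombus a b) :=
    ((hB.bdd_mul (c := 1) (Measurable.aestronglyMeasurable (by fun_prop))
      (Filter.Eventually.of_forall fun p => abs_div_abs_self_le_one p.2)).bdd_mul (c := 1)
      (Measurable.aestronglyMeasurable (by fun_prop))
      (Filter.Eventually.of_forall fun p => abs_div_abs_self_le_one p.1)).const_mul 2
  rw [hD]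
  refine ⟨(integrable_indicator_iff hR.measurableSet).2 (hsi.add hri), ?_⟩
  rw [integral_indicator hR.measurableSet, integral_add' hsi hri]
  have hr0 : ∫ p in closedRhombus a b, r p = 0 := by
    rw [← integral_indicator hR.measurableSet]
    refine integral_eq_zero_of_odd_fst fun x y => ?_
    have hmem : (-x, y) ∈ closedRhombus a b ↔ (x, y) ∈ closedRhombus a b := by
      simp [closedRhombus]
    by_cases hp : (x, y) ∈ closedRhombus a b
    · rw [indicator_of_mem hp, indicator_of_mem (hmem.2 hp)]
      simp only [hr, abs_neg]
      ring
    · rw [indicator_of_notMem hp, indicator_of_notMem (mt hmem.1 hp), neg_zero]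
  rw [hr0, add_zero, ← setIntegral_closedRhombus ha hb hg]
  refine integral_mono hsi ((hA (1, 0)).add (hA (0, 1))) fun p => ?_
  exact add_le_add (mul_le_of_le_one_left (sq_nonneg _) (div_abs_self_sq_le_one _))
    (mul_le_of_le_one_left (sq_nonneg _) (div_abs_self_sq_le_one _))

/-- The mixed Poincaré inequality on the right triangle with legs `a` and `b` along the axes. -/
lemma poincare_legTriangle {a b : ℝ} (ha : 0 < a) (hb : 0 < b) {v : ℝ × ℝ → ℝ}
    (hv : ContDiff ℝ 1 v)
    (h0 : ∀ p : ℝ × ℝ, 0 ≤ p.1 → 0 ≤ p.2 → p.1 / a + p.2 / b = 1 → v p = 0) :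
    Real.pi ^ 2 / (a * b) * ∫ p in legTriangle a b, v p ^ 2 ≤
      ∫ p in legTriangle a b, (fderiv ℝ v p (1, 0) ^ 2 + fderiv ℝ v p (0, 1) ^ 2) := by
  have hR := isCompact_closedRhombus ha hb
  have hvc := hv.continuous
  have hU2 : (fun p => evenExt a b v p ^ 2) =
      (closedRhombus a b).indicator fun p => v (|p.1|, |p.2|) ^ 2 := by
    ext p
    by_cases hp : p ∈ closedRhombus a b <;> simp [evenExt, hp]
  have hU2i : Integrable fun p => evenExt a b v p ^ 2 := by
    rw [hU2, integrable_indicator_iff hR.measurableSet]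
    exact (Continuous.continuousOn (by fun_prop)).integrableOn_compact hR
  have hU2int : ∫ p, evenExt a b v p ^ 2 = 4 * ∫ p in legTriangle a b, v p ^ 2 := by
    rw [hU2, integral_indicator hR.measurableSet]
    exact setIntegral_closedRhombus ha hb (g := fun p => v p ^ 2) (by fun_prop)
  obtain ⟨hD2i, hD2le⟩ := integral_evenExtDeriv_sq ha hb hv
  obtain ⟨-, hUm, hUeq⟩ := integral_diagonal hU2i
  obtain ⟨hDl, hDm, hDeq⟩ := integral_diagonal hD2i
  obtain ⟨hD1, -, -⟩ := integral_diagonal (integrable_evenExtDeriv ha hb hv)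
  have hUc := continuous_evenExt hvc h0
  have hρ : 0 < a * b / (a + b) := by positivity
  have hline : ∀ᵐ m : ℝ, (Real.pi / (2 * (a * b / (a + b)))) ^ 2 *
      ∫ t, evenExt a b v (t, t + m) ^ 2 ≤ ∫ t, evenExtDeriv a b v (t, t + m) ^ 2 := by
    filter_upwards [hDl, hD1, compl_mem_ae_iff.2 (measure_singleton b),
      compl_mem_ae_iff.2 (measure_singleton (-b))] with m h1 h2 h3 h4
    refine poincare_interval (S := {0} ∪ {-m} ∪ {t : ℝ | |t| / a + |t + m| / b = 1})
      (c := -(m * a / (a + b))) (((finite_singleton _).union (finite_singleton _)).union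
        (finite_diagonal_inter_frontier ha hb h3 h4)).countable hρ (by fun_prop) ?_ ?_ h2 h1
    · intro t ht
      refine evenExt_eq_zero h0 ?_
      have hab : 0 < a + b := by positivity
      have e1 : t / a + (t + m) / b = (t - -(m * a / (a + b))) / (a * b / (a + b)) := by
        field_simp
        ring
      have e2 : 1 ≤ |t / a + (t + m) / b| := by
        rw [e1, abs_div, abs_of_pos hρ, one_le_div hρ]
        exact ht
      refine e2.trans ((abs_add_le _ _).trans ?_)
      rw [abs_div, abs_div, abs_of_pos ha, abs_of_pos hb]
    · intro t ht
      simp only [mem_union, mem_singleton_iff, mem_ofPred_eq, not_or] at ht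
      exact hasDerivAt_evenExt hv ht.1.1 (fun h => ht.1.2 (by linarith)) ht.2
  have hmono := integral_mono_ae (hUm.const_mul _) hDm hline
  rw [integral_const_mul, ← hUeq, ← hDeq, hU2int] at hmono
  have hk : Real.pi ^ 2 / (a * b) ≤ (Real.pi / (2 * (a * b / (a + b)))) ^ 2 := by
    have : (Real.pi / (2 * (a * b / (a + b)))) ^ 2 =
        Real.pi ^ 2 / (a * b) * ((a + b) ^ 2 / (4 * (a * b))) := by
      field_simp
      ring
    rw [this]
    refine le_mul_of_one_le_right (by positivity) ?_
    rw [one_le_div (by positivity)]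
    nlinarith [sq_nonneg (a - b)]
  have hnn : 0 ≤ ∫ p in legTriangle a b, v p ^ 2 := integral_nonneg fun p => sq_nonneg _
  have := mul_le_mul_of_nonneg_right hk hnn
  linarith

lemma half_mul_le_volume_legTriangle {a b : ℝ} (ha : 0 < a) (hb : 0 < b) :
    a * b / 2 ≤ (volume (legTriangle a b)).toReal := by
  have hsub : regionBetween (fun _ => 0) (fun x => b * (1 - x / a)) (Ioc 0 a) ⊆
      legTriangle a b := by
    rintro ⟨x, y⟩ ⟨hx, hy⟩
    have hx1 : 0 < x := hx.1
    have hy1 : 0 < y := hy.1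
    have hy2 : y < b * (1 - x / a) := hy.2
    refine ⟨hx1.le, hy1.le, ?_⟩
    have : y / b < 1 - x / a := (div_lt_iff₀ hb).2 (by linarith)
    change x / a + y / b ≤ 1
    linarith
  have hvol := volume_regionBetween_eq_integral (μ := volume) (s := Ioc 0 a) (f := fun _ => 0)
    (g := fun x => b * (1 - x / a)) integrableOn_zero
    ((by fun_prop : Continuous fun x : ℝ => b * (1 - x / a)).integrableOn_Ioc) measurableSet_Ioc
    (fun x hx => mul_nonneg hb.le (sub_nonneg.2 ((div_le_one ha).2 hx.2)))
  have hint : ∫ x in Ioc 0 a, ((fun x : ℝ => b * (1 - x / a)) - (fun _ => 0) : ℝ → ℝ) x =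
      a * b / 2 := by
    rw [← intervalIntegral.integral_of_le ha.le]
    simp only [Pi.sub_apply, sub_zero, intervalIntegral.integral_const_mul]
    rw [intervalIntegral.integral_sub (by simp) ((by fun_prop :
      Continuous fun x : ℝ => x / a).intervalIntegrable _ _), intervalIntegral.integral_div]
    simp
    field_simp
    ring
  rw [hint, ← Measure.volume_eq_prod] at hvol
  have := ENNReal.toReal_mono
    ((isCompact_legTriangle ha hb).measure_ne_top (μ := volume)) (measure_mono hsub)
  rwa [hvol, ENNReal.toReal_ofReal (by positivity)] at this

/-- The isometric parametrization of the plane with origin `A` by the coordinates with respect to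
an orthonormal basis. -/
def planeCoord (A : E2) (e : OrthonormalBasis (Fin 2) ℝ E2) : ℝ × ℝ ≃ᵐ E2 :=
  (((MeasurableEquiv.finTwoArrow (α := ℝ)).symm.trans
    (MeasurableEquiv.toLp 2 (Fin 2 → ℝ))).trans e.measurableEquiv.symm).trans
      (MeasurableEquiv.addLeft A)

lemma planeCoord_apply (A : E2) (e : OrthonormalBasis (Fin 2) ℝ E2) (p : ℝ × ℝ) :
    planeCoord A e p = A + (p.1 • e 0 + p.2 • e 1) := by
  change A + e.repr.symm (WithLp.toLp 2 ((MeasurableEquiv.finTwoArrow (α := ℝ)).symm p)) = _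
  rw [← e.sum_repr_symm]
  simp [Fin.sum_univ_two, MeasurableEquiv.finTwoArrow]

lemma measurePreserving_planeCoord (A : E2) (e : OrthonormalBasis (Fin 2) ℝ E2) :
    MeasurePreserving (planeCoord A e) volume volume :=
  (((volume_preserving_finTwoArrow ℝ).symm.trans
    (EuclideanSpace.volume_preserving_symm_measurableEquiv_toLp (Fin 2)).symm).trans
      e.measurePreserving_measurableEquiv.symm).trans (measurePreserving_add_left volume A)

lemma contDiff_planeCoord (A : E2) (e : OrthonormalBasis (Fin 2) ℝ E2) :
    ContDiff ℝ 1 (planeCoord A e) := by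
  have : (planeCoord A e : ℝ × ℝ → E2) = fun p => A + (p.1 • e 0 + p.2 • e 1) :=
    funext (planeCoord_apply A e)
  rw [this]
  fun_prop

lemma fderiv_comp_planeCoord (A : E2) (e : OrthonormalBasis (Fin 2) ℝ E2) {u : E2 → ℝ}
    (hu : Differentiable ℝ u) (p w : ℝ × ℝ) :
    fderiv ℝ (fun q => u (planeCoord A e q)) p w =
      fderiv ℝ u (planeCoord A e p) (w.1 • e 0 + w.2 • e 1) := by
  have h : HasFDerivAt (planeCoord A e)
      ((ContinuousLinearMap.fst ℝ ℝ ℝ).smulRight (e 0) +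
        (ContinuousLinearMap.snd ℝ ℝ ℝ).smulRight (e 1)) p := by
    have : (planeCoord A e : ℝ × ℝ → E2) = fun p => A + (p.1 • e 0 + p.2 • e 1) :=
      funext (planeCoord_apply A e)
    rw [this]
    exact ((hasFDerivAt_fst.smul_const (e 0)).add (hasFDerivAt_snd.smul_const (e 1))).const_add A
  have h' := (hu (planeCoord A e p)).hasFDerivAt.comp p h
  have h'' : fderiv ℝ (fun q => u (planeCoord A e q)) p = _ := h'.fderiv
  rw [h'']
  simp

lemma norm_sq_dual_eq (e : OrthonormalBasis (Fin 2) ℝ E2) (L : E2 →L[ℝ] ℝ) :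
    ‖L‖ ^ 2 = L (e 0) ^ 2 + L (e 1) ^ 2 := by
  set z := (InnerProductSpace.toDual ℝ E2).symm L with hz
  have hL : ∀ x, L x = inner ℝ z x := fun x => by simp [hz]
  have hn : ‖L‖ = ‖z‖ := by simp [hz]
  rw [hn, ← e.sum_sq_norm_inner_left z, Fin.sum_univ_two, hL, hL]
  simp

lemma preimage_planeCoord_convexHull {A : E2} (e : OrthonormalBasis (Fin 2) ℝ E2) {a b : ℝ}
    (ha : 0 < a) (hb : 0 < b) :
    planeCoord A e ⁻¹' (convexHull ℝ {A, A + a • e 0, A + b • e 1}) = legTriangle a b := by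
  ext p
  rw [mem_preimage, planeCoord_apply]
  constructor
  · intro hp
    have he : ∀ i j, inner ℝ (e i) (e j) = if i = j then (1 : ℝ) else 0 := fun i j =>
      orthonormal_iff_ite.1 e.orthonormal i j
    let K : Set E2 := {z | 0 ≤ inner ℝ (e 0) (z - A)} ∩ ({z | 0 ≤ inner ℝ (e 1) (z - A)} ∩
      {z | inner ℝ (e 0) (z - A) / a + inner ℝ (e 1) (z - A) / b ≤ 1})
    have hK : Convex ℝ K := by
      intro x hx y hy s t hs ht hst
      obtain ⟨x1, x2, x3⟩ := hx
      obtain ⟨y1, y2, y3⟩ := hy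
      simp only [mem_ofPred_eq] at x1 x2 x3 y1 y2 y3
      have e1 : s • x + t • y - A = s • (x - A) + t • (y - A) := by
        obtain rfl : s = 1 - t := by linarith
        module
      refine ⟨?_, ?_, ?_⟩ <;> simp only [mem_ofPred_eq, e1, inner_add_right, inner_smul_right]
      · positivity
      · positivity
      · have := add_le_add (mul_le_mul_of_nonneg_left x3 hs) (mul_le_mul_of_nonneg_left y3 ht)
        calc _ = _ := ?_
          _ ≤ _ := this
          _ = 1 := by linarith
        ring
    have hmem := convexHull_min (s := {A, A + a • e 0, A + b • e 1}) (t := K) (by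
      rintro z (rfl | rfl | rfl)
      · simp [K]
      · simp [K, inner_smul_right, he, ha.le, ha.ne']
      · simp [K, inner_smul_right, he, hb.le, hb.ne']) hK hp
    simpa [K, inner_add_right, inner_smul_right, he, legTriangle] using hmem
  · rintro ⟨h1, h2, h3⟩
    have hs := convex_convexHull ℝ {A, A + a • e 0, A + b • e 1}
    have hsub := subset_convexHull ℝ {A, A + a • e 0, A + b • e 1}
    have h := hs.sum_mem (t := Finset.univ) (w := ![1 - p.1 / a - p.2 / b, p.1 / a, p.2 / b])
      (z := ![A, A + a • e 0, A + b • e 1]) (by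
        intro i _
        fin_cases i
        · simp only [Fin.zero_eta, Matrix.cons_val_zero]
          linarith
        · exact div_nonneg h1 ha.le
        · exact div_nonneg h2 hb.le) (by
        simp only [Fin.sum_univ_three, Matrix.cons_val_zero, Matrix.cons_val_one, Matrix.cons_val]
        ring) (by
        intro i _
        fin_cases i <;> exact hsub (by simp))
    convert h using 1
    have e1 : p.1 • e 0 = (p.1 / a) • a • e 0 := by rw [smul_smul, div_mul_cancel₀ _ ha.ne']
    have e2 : p.2 • e 1 = (p.2 / b) • b • e 1 := by rw [smul_smul, div_mul_cancel₀ _ hb.ne']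
    simp only [Fin.sum_univ_three, Matrix.cons_val_zero, Matrix.cons_val_one, Matrix.cons_val]
    rw [e1, e2]
    module

lemma planeCoord_mem_segment {A : E2} (e : OrthonormalBasis (Fin 2) ℝ E2) {a b : ℝ}
    (ha : 0 < a) (hb : 0 < b) {p : ℝ × ℝ} (h1 : 0 ≤ p.1) (h2 : 0 ≤ p.2)
    (h : p.1 / a + p.2 / b = 1) :
    planeCoord A e p ∈ segment ℝ (A + a • e 0) (A + b • e 1) := by
  refine ⟨p.1 / a, p.2 / b, div_nonneg h1 ha.le, div_nonneg h2 hb.le, h, ?_⟩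
  have e1 : p.1 • e 0 = (p.1 / a) • a • e 0 := by rw [smul_smul, div_mul_cancel₀ _ ha.ne']
  have e2 : p.2 • e 1 = (p.2 / b) • b • e 1 := by rw [smul_smul, div_mul_cancel₀ _ hb.ne']
  rw [planeCoord_apply, e1, e2]
  have : p.2 / b = 1 - p.1 / a := by linarith
  rw [this]
  module

lemma exists_orthonormalBasis_legs {A B C : E2} (hT : ¬ Collinear ℝ ({A, B, C} : Set E2))
    (hright : ∠ B A C = Real.pi / 2) :
    ∃ (e : OrthonormalBasis (Fin 2) ℝ E2) (a b : ℝ), 0 < a ∧ 0 < b ∧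
      B = A + a • e 0 ∧ C = A + b • e 1 := by
  have hin : inner ℝ (B - A) (C - A) = 0 :=
    (InnerProductGeometry.inner_eq_zero_iff_angle_eq_pi_div_two _ _).2 hright
  have hp : B - A ≠ 0 := by
    intro h
    rw [sub_eq_zero] at h
    subst h
    exact hT (by simpa using collinear_pair ℝ B C)
  have hq : C - A ≠ 0 := by
    intro h
    rw [sub_eq_zero] at h
    subst h
    exact hT (by simpa [insert_comm] using collinear_pair ℝ B C)
  have hp' := norm_pos_iff.2 hp
  have hq' := norm_pos_iff.2 hq
  have hv : Orthonormal ℝ ![‖B - A‖⁻¹ • (B - A), ‖C - A‖⁻¹ • (C - A)] := by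
    rw [orthonormal_vecCons_iff]
    refine ⟨?_, ?_, ?_⟩
    · rw [norm_smul, norm_inv, norm_norm, inv_mul_cancel₀ hp'.ne']
    · intro i
      fin_cases i
      simp [inner_smul_left, inner_smul_right, hin]
    · rw [orthonormal_vecCons_iff]
      refine ⟨?_, fun i => i.elim0, ?_⟩
      · rw [norm_smul, norm_inv, norm_norm, inv_mul_cancel₀ hq'.ne']
      · exact ⟨fun i => i.elim0, fun i => i.elim0⟩
  let e := (basisOfOrthonormalOfCardEqFinrank hv (by simp)).toOrthonormalBasis (by simpa using hv)
  have he : ∀ i, e i = ![‖B - A‖⁻¹ • (B - A), ‖C - A‖⁻¹ • (C - A)] i := fun i => by simp [e]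
  refine ⟨e, ‖B - A‖, ‖C - A‖, hp', hq', ?_, ?_⟩
  · rw [he]
    simp [smul_smul, hp'.ne']
  · rw [he]
    simp [smul_smul, hq'.ne']

lemma triangleO_ae_eq (A B C : E2) :
    triangleO A B C =ᵐ[volume] convexHull ℝ ({A, B, C} : Set E2) :=
  interior_ae_eq_of_null_frontier ((convex_convexHull ℝ _).addHaar_frontier volume)

lemma setIntegral_triangleO {A : E2} (e : OrthonormalBasis (Fin 2) ℝ E2) {a b : ℝ}
    (ha : 0 < a) (hb : 0 < b) (g : E2 → ℝ) :
    ∫ x in triangleO A (A + a • e 0) (A + b • e 1), g x =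
      ∫ p in legTriangle a b, g (planeCoord A e p) := by
  rw [setIntegral_congr_set (triangleO_ae_eq _ _ _), ← preimage_planeCoord_convexHull e ha hb,
    (measurePreserving_planeCoord A e).setIntegral_preimage_emb
      (planeCoord A e).measurableEmbedding]

lemma le_rayleigh_triangleO {A : E2} (e : OrthonormalBasis (Fin 2) ℝ E2) {a b : ℝ}
    (ha : 0 < a) (hb : 0 < b) {u : E2 → ℝ} (hu : ContDiff ℝ (⊤ : ℕ∞) u)
    (h0 : ∀ x ∈ segment ℝ (A + a • e 0) (A + b • e 1), u x = 0)
    (hne : NotAEZero (triangleO A (A + a • e 0) (A + b • e 1)) u) :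
    Real.pi ^ 2 / (a * b) ≤ rayleigh (triangleO A (A + a • e 0) (A + b • e 1)) u := by
  have hu1 : ContDiff ℝ 1 u := hu.of_le (by norm_num)
  have hpos : 0 < ∫ x in triangleO A (A + a • e 0) (A + b • e 1), u x ^ 2 := by
    refine lt_of_le_of_ne (integral_nonneg fun x => sq_nonneg _) fun h => hne ?_
    have hcpt : IsCompact (convexHull ℝ ({A, A + a • e 0, A + b • e 1} : Set E2)) :=
      (Set.toFinite _).isCompact_convexHull ℝ
    have hi : IntegrableOn (fun x => u x ^ 2) (triangleO A (A + a • e 0) (A + b • e 1)) :=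
      ((hu.continuous.pow 2).continuousOn.integrableOn_compact hcpt).mono_set interior_subset
    have := (integral_eq_zero_iff_of_nonneg (fun x => sq_nonneg (u x)) hi).1 h.symm
    filter_upwards [this] with x hx
    exact pow_eq_zero_iff two_ne_zero |>.1 hx
  rw [rayleigh, le_div_iff₀ hpos, setIntegral_triangleO e ha hb, setIntegral_triangleO e ha hb]
  have key := poincare_legTriangle ha hb (v := fun p => u (planeCoord A e p))
    (hu1.comp (contDiff_planeCoord A e))
    fun p h1 h2 h => h0 _ (planeCoord_mem_segment e ha hb h1 h2 h)
  refine key.trans_eq (integral_congr_ae (Filter.Eventually.of_forall fun p => ?_))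
  simp only [fderiv_comp_planeCoord A e (hu1.differentiable one_ne_zero), norm_sq_dual_eq e]
  simp

/-- The affine function vanishing on the hypotenuse is admissible. -/
lemma exists_admissible {A : E2} (e : OrthonormalBasis (Fin 2) ℝ E2) {a b : ℝ}
    (ha : 0 < a) (hb : 0 < b) :
    ∃ u : E2 → ℝ, ContDiff ℝ (⊤ : ℕ∞) u ∧
      (∀ x ∈ segment ℝ (A + a • e 0) (A + b • e 1), u x = 0) ∧
      NotAEZero (triangleO A (A + a • e 0) (A + b • e 1)) u := by
  have he : ∀ i j, inner ℝ (e i) (e j) = if i = j then (1 : ℝ) else 0 := fun i j =>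
    orthonormal_iff_ite.1 e.orthonormal i j
  let u : E2 → ℝ := fun z => 1 - inner ℝ (e 0) (z - A) / a - inner ℝ (e 1) (z - A) / b
  have hu : ContDiff ℝ (⊤ : ℕ∞) u :=
    (contDiff_const.sub ((contDiff_const.inner ℝ (contDiff_id.sub contDiff_const)).div_const a)).sub
      ((contDiff_const.inner ℝ (contDiff_id.sub contDiff_const)).div_const b)
  refine ⟨u, hu, ?_, fun hz => ?_⟩
  · rintro x ⟨s, t, hs, ht, hst, rfl⟩
    have e1 : s • (A + a • e 0) + t • (A + b • e 1) - A = (s * a) • e 0 + (t * b) • e 1 := by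
      obtain rfl : s = 1 - t := by linarith
      module
    simp only [u, e1, inner_add_right, inner_smul_right, he]
    field_simp
    norm_num
    obtain rfl : s = 1 - t := by linarith
    ring
  · have h1 : ∀ᵐ x ∂volume.restrict (convexHull ℝ ({A, A + a • e 0, A + b • e 1} : Set E2)),
        u x = 0 := by
      rwa [← Measure.restrict_congr_set (triangleO_ae_eq _ _ _)]
    have h2 : ∀ᵐ p ∂volume.restrict (legTriangle a b), u (planeCoord A e p) = 0 := by
      rw [← preimage_planeCoord_convexHull e ha hb]
      exact ((measurePreserving_planeCoord A e).restrict_preimage_emb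
        (planeCoord A e).measurableEmbedding _).quasiMeasurePreserving.ae h1
    have hsub : Ioo 0 (a / 2) ×ˢ Ioo 0 (b / 2) ⊆ legTriangle a b := by
      rintro p ⟨⟨h1, h2⟩, h3, h4⟩
      refine ⟨h1.le, h3.le, ?_⟩
      have h5 : p.1 / a < 1 / 2 := by rw [div_lt_iff₀ ha]; linarith
      have h6 : p.2 / b < 1 / 2 := by rw [div_lt_iff₀ hb]; linarith
      linarith
    have h3 := Measure.eqOn_open_of_ae_eq (g := fun _ => 0)
      (ae_restrict_of_ae_restrict_of_subset hsub h2) (isOpen_Ioo.prod isOpen_Ioo)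
      (hu.continuous.comp (contDiff_planeCoord A e).continuous).continuousOn continuousOn_const
      (show (a / 4, b / 4) ∈ Ioo 0 (a / 2) ×ˢ Ioo 0 (b / 2) from
        ⟨⟨by positivity, by linarith⟩, ⟨by positivity, by linarith⟩⟩)
    simp only [u, planeCoord_apply, add_sub_cancel_left, inner_add_right, inner_smul_right,
      he] at h3
    field_simp at h3
    norm_num at h3
    nlinarith [mul_pos ha hb]

/-- For every nondegenerate right triangle `T_R = △ABC` (right angle at `A`,
hypotenuse `BC`), the first mixed eigenvalue with Dirichlet condition on the hypotenuse and
Neumann condition on the two legs satisfies `λ₁^L(T_R) ≥ π²/(2|T_R|)`. -/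
theorem stmt_4 (A B C : E2)
    (hT : ¬ Collinear ℝ ({A, B, C} : Set E2))
    (hright : ∠ B A C = Real.pi / 2) :
    firstMixedEig (triangleO A B C) (segment ℝ B C) ≥
      Real.pi ^ 2 / (2 * area2 (convexHull ℝ ({A, B, C} : Set E2))) := by
  obtain ⟨e, a, b, ha, hb, rfl, rfl⟩ := exists_orthonormalBasis_legs hT hright
  have harea : a * b ≤ 2 * area2 (convexHull ℝ ({A, A + a • e 0, A + b • e 1} : Set E2)) := by
    rw [area2, ← (measurePreserving_planeCoord A e).measure_preimage_equiv,
      preimage_planeCoord_convexHull e ha hb]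
    linarith [half_mul_le_volume_legTriangle ha hb]
  refine le_trans (div_le_div_of_nonneg_left (sq_nonneg _) (by positivity) harea) ?_
  obtain ⟨u, hu, hu0, hune⟩ := exists_admissible (A := A) e ha hb
  refine le_csInf ⟨_, u, hu, hu0, hune, rfl⟩ ?_
  rintro r ⟨w, hw, hw0, hwne, rfl⟩
  exact le_rayleigh_triangleO e ha hb hw hw0 hwne

end
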